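/- arXiv:math/9912125 — 3 statements merged into one kernel-verified Lean document; each statement's English description precedes it below -/
import Mathlib

section
/- Let u ∈ S_n, let x ∈ N be totally nonnegative with x u⁻¹ ∈ G_0, and set A = u⁻¹ [x u⁻¹]_+ u (an invertible matrix). Then for all indices 1 ≤ i ≤ n and 1 ≤ j ≤ n-1: (1) if i ≤ j and u(j) ≤ u(i) ≤ u(j+1), then (A⁻¹)_{j,i} · A_{i,j+1} ≥ 0; (2) if j < i and u(j) ≤ u(i) ≤ u(j+1), then (A⁻¹)_{j,i} · A_{i,j+1} ≤ 0; (3) if the condition u(j) ≤ u(i) ≤ u(j+1) does not hold, then (A⁻¹)_{j,i} · A_{i,j+1} = 0. -/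
open scoped Classical

namespace BruhatTNN

abbrev Mat (n : ℕ) := Matrix (Fin n) (Fin n) ℝ

/-- `x` is upper unitriangular. -/
def upperUni {n : ℕ} (x : Mat n) : Prop :=
  (∀ i, x i i = 1) ∧ ∀ i j : Fin n, j < i → x i j = 0

/-- `x` is lower unitriangular. -/
def lowerUni {n : ℕ} (x : Mat n) : Prop :=
  (∀ i, x i i = 1) ∧ ∀ i j : Fin n, i < j → x i j = 0

/-- `x` is invertible upper triangular (`x ∈ B`). -/
def upperTriInv {n : ℕ} (x : Mat n) : Prop :=
  IsUnit x.det ∧ ∀ i j : Fin n, j < i → x i j = 0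

/-- `x` is invertible lower triangular (`x ∈ B_-`). -/
def lowerTriInv {n : ℕ} (x : Mat n) : Prop :=
  IsUnit x.det ∧ ∀ i j : Fin n, i < j → x i j = 0

/-- `x` is invertible diagonal (`x ∈ H`). -/
def diagInv {n : ℕ} (x : Mat n) : Prop :=
  IsUnit x.det ∧ ∀ i j : Fin n, i ≠ j → x i j = 0

/-- `x` admits a Gaussian decomposition (`x ∈ G_0`). -/
def hasGauss {n : ℕ} (x : Mat n) : Prop :=
  ∃ a d b : Mat n, lowerUni a ∧ diagInv d ∧ upperUni b ∧ x = a * d * b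

/-- The factor `[x]_-` of the Gaussian decomposition (junk value `1` if none exists). -/
noncomputable def gaussMinus {n : ℕ} (x : Mat n) : Mat n :=
  if h : hasGauss x then h.choose else 1

/-- The factor `[x]_0` of the Gaussian decomposition (junk value `1` if none exists). -/
noncomputable def gaussDiag {n : ℕ} (x : Mat n) : Mat n :=
  if h : hasGauss x then h.choose_spec.choose else 1

/-- The factor `[x]_+` of the Gaussian decomposition (junk value `1` if none exists). -/
noncomputable def gaussPlus {n : ℕ} (x : Mat n) : Mat n :=
  if h : hasGauss x then h.choose_spec.choose_spec.choose else 1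

/-- The permutation matrix of `w`, with entry `1` in position `(w j, j)`. -/
def permMat {n : ℕ} (w : Equiv.Perm (Fin n)) : Mat n :=
  Matrix.of fun i j => if i = w j then (1 : ℝ) else 0

/-- The minor of `x` with row set `I` and column set `J` (taken in increasing order). -/
def minorOf {n : ℕ} (x : Mat n) (k : ℕ) (I J : Finset (Fin n))
    (hI : I.card = k) (hJ : J.card = k) : ℝ :=
  Matrix.det (Matrix.of fun a b : Fin k => x (I.orderEmbOfFin hI a) (J.orderEmbOfFin hJ b))

/-- `x` is totally nonnegative: all its minors are nonnegative. -/
def totNonneg {n : ℕ} (x : Mat n) : Prop :=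
  ∀ (k : ℕ) (I J : Finset (Fin n)) (hI : I.card = k) (hJ : J.card = k),
    0 ≤ minorOf x k I J hI hJ

/-- The Bruhat order on the symmetric group. -/
def bruhatLE {n : ℕ} (u v : Equiv.Perm (Fin n)) : Prop :=
  ∀ i j : Fin n,
    (Finset.univ.filter fun k : Fin n => k ≤ i ∧ j ≤ u k).card ≤
    (Finset.univ.filter fun k : Fin n => k ≤ i ∧ j ≤ v k).card

/-- The double coset `B_- w B_-`. -/
def doubleCosetBm {n : ℕ} (w : Equiv.Perm (Fin n)) : Set (Mat n) :=
  {x | ∃ b₁ b₂ : Mat n, lowerTriInv b₁ ∧ lowerTriInv b₂ ∧ x = b₁ * permMat w * b₂}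

/-- `N^w = B_- w B_- ∩ N`. -/
def Ncell {n : ℕ} (w : Equiv.Perm (Fin n)) : Set (Mat n) :=
  {x | upperUni x ∧ x ∈ doubleCosetBm w}

/-- `N_-(w) = w⁻¹ N w ∩ N_-`. -/
def Nminus {n : ℕ} (w : Equiv.Perm (Fin n)) : Set (Mat n) :=
  {x | lowerUni x ∧ ∃ y : Mat n, upperUni y ∧ x = permMat w⁻¹ * y * permMat w}

/-- `N(w) = w⁻¹ N w ∩ N`. -/
def Ngrp {n : ℕ} (w : Equiv.Perm (Fin n)) : Set (Mat n) :=
  {x | upperUni x ∧ ∃ y : Mat n, upperUni y ∧ x = permMat w⁻¹ * y * permMat w}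

/-- The totally positive cell `Y°_w = Y ∩ B_- w B_-`. -/
def Ycirc {n : ℕ} (w : Equiv.Perm (Fin n)) : Set (Mat n) :=
  {x | upperUni x ∧ totNonneg x ∧ x ∈ doubleCosetBm w}

/-- `Y_{≥ u} = ⋃_{v ≥ u} Y°_v`. -/
def Yge {n : ℕ} (u : Equiv.Perm (Fin n)) : Set (Mat n) :=
  {x | ∃ v, bruhatLE u v ∧ x ∈ Ycirc v}

/-- `A = u⁻¹ [x u⁻¹]_+ u`. -/
noncomputable def Amat {n : ℕ} (u : Equiv.Perm (Fin n)) (x : Mat n) : Mat n :=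
  permMat u⁻¹ * gaussPlus (x * permMat u⁻¹) * permMat u

/-- The projection `π_u(x) = [u [u⁻¹ [x u⁻¹]_+ u]_-]_+`. -/
noncomputable def piMap {n : ℕ} (u : Equiv.Perm (Fin n)) (x : Mat n) : Mat n :=
  gaussPlus (permMat u * gaussMinus (Amat u x))

/-- `str(M)`: the sum of the matrix entries immediately above the main diagonal. -/
def strAbove {n : ℕ} (M : Mat n) : ℝ :=
  ∑ p : Fin n × Fin n, if (p.1 : ℕ) + 1 = (p.2 : ℕ) then M p.1 p.2 else 0

/-- The number of inversions (the length) of a permutation. -/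
def invNum {n : ℕ} (w : Equiv.Perm (Fin n)) : ℕ :=
  (Finset.univ.filter fun p : Fin n × Fin n => p.1 < p.2 ∧ w p.2 < w p.1).card

section Signs

open Matrix Finset

/-- Determinants of the first `k` rows of `x`, with columns listed by an arbitrary function `g`. -/
def topMinor {n k : ℕ} (x : Mat n) (hk : k ≤ n) (g : Fin k → Fin n) : ℝ :=
  Matrix.det (Matrix.of fun a b : Fin k => x (Fin.castLE hk a) (g b))

/-- The Vandermonde determinant of the column indices; its sign is the sign of the sorting
permutation. -/
def vdm {n k : ℕ} (g : Fin k → Fin n) : ℝ :=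
  (Matrix.vandermonde fun a => ((g a : ℕ) : ℝ)).det

lemma topMinor_comp {n k : ℕ} (x : Mat n) (hk : k ≤ n) (g : Fin k → Fin n)
    (σ : Equiv.Perm (Fin k)) :
    topMinor x hk (g ∘ σ) = (Equiv.Perm.sign σ : ℤ) * topMinor x hk g :=
  Matrix.det_permute' σ (Matrix.of fun a b : Fin k => x (Fin.castLE hk a) (g b))

lemma vdm_comp {n k : ℕ} (g : Fin k → Fin n) (σ : Equiv.Perm (Fin k)) :
    vdm (g ∘ σ) = (Equiv.Perm.sign σ : ℤ) * vdm g :=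
  Matrix.det_permute σ (Matrix.vandermonde fun a => ((g a : ℕ) : ℝ))

lemma sign_mul_self {k : ℕ} (σ : Equiv.Perm (Fin k)) :
    ((Equiv.Perm.sign σ : ℤ) : ℝ) * (Equiv.Perm.sign σ : ℤ) = 1 := by
  rcases Int.units_eq_one_or (Equiv.Perm.sign σ) with h | h <;> simp [h]

lemma vdm_pos_of_strictMono {n k : ℕ} {g : Fin k → Fin n} (hg : StrictMono g) : 0 < vdm g := by
  rw [vdm, Matrix.det_vandermonde]
  refine prod_pos fun a _ => prod_pos fun b hb => ?_
  have : ((g a : ℕ) : ℝ) < (g b : ℕ) := by exact_mod_cast hg (mem_Ioi.1 hb)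
  linarith

lemma vdm_ne_zero {n k : ℕ} {g : Fin k → Fin n} (hg : Function.Injective g) : vdm g ≠ 0 := by
  rw [vdm, Matrix.det_vandermonde_ne_zero_iff]
  intro a b h
  exact hg (Fin.ext (Nat.cast_injective (R := ℝ) h))

lemma topMinor_nonneg_of_strictMono {n k : ℕ} {x : Mat n} (hx : totNonneg x) (hk : k ≤ n)
    {g : Fin k → Fin n} (hg : StrictMono g) : 0 ≤ topMinor x hk g := by
  have hI : (univ.image (Fin.castLE hk)).card = k := by
    rw [card_image_of_injective _ (Fin.castLE_injective hk)]; simp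
  have hJ : (univ.image g).card = k := by
    rw [card_image_of_injective _ hg.injective]; simp
  have h := hx k _ _ hI hJ
  have h1 : Fin.castLE hk = (univ.image (Fin.castLE hk)).orderEmbOfFin hI :=
    orderEmbOfFin_unique hI (by simp) (Fin.strictMono_castLE hk)
  have h2 : g = (univ.image g).orderEmbOfFin hJ :=
    orderEmbOfFin_unique hJ (by simp) hg
  rw [minorOf, ← h1, ← h2] at h
  exact h

lemma topMinor_mul_vdm_nonneg {n k : ℕ} {x : Mat n} (hx : totNonneg x) (hk : k ≤ n)
    (g : Fin k → Fin n) : 0 ≤ topMinor x hk g * vdm g := by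
  by_cases hg : Function.Injective g
  · have hm : StrictMono (g ∘ Tuple.sort g) :=
      (Tuple.monotone_sort g).strictMono_of_injective (hg.comp (Tuple.sort g).injective)
    have h := mul_nonneg (topMinor_nonneg_of_strictMono hx hk hm) (vdm_pos_of_strictMono hm).le
    rw [topMinor_comp, vdm_comp] at h
    linear_combination h + topMinor x hk g * vdm g * sign_mul_self (Tuple.sort g)
  · have : vdm g = 0 := by
      by_contra h
      rw [← ne_eq, vdm, Matrix.det_vandermonde_ne_zero_iff] at h
      exact hg fun a b hab => h (by simp [hab])
    simp [this]

lemma vdm_succ {n k : ℕ} (g : Fin (k + 1) → Fin n) :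
    vdm g = (∏ a : Fin k, (((g a.succ : ℕ) : ℝ) - (g 0 : ℕ))) * vdm (g ∘ Fin.succ) := by
  simp [vdm, Matrix.det_vandermonde, Fin.prod_univ_succ, Fin.prod_Ioi_succ]

/-- Replacing one column index changes the sign of the Vandermonde determinant by the expected
product of differences. -/
lemma vdm_update_mul {n k : ℕ} {g : Fin k → Fin n} (hg : Function.Injective g) (p : Fin k)
    (t : Fin n) :
    ∃ W : ℝ, 0 < W ∧ vdm (Function.update g p t) * vdm g =
      W * ∏ q ∈ univ.erase p, ((((g q : ℕ) : ℝ) - (t : ℕ)) * (((g q : ℕ) : ℝ) - (g p : ℕ))) := by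
  cases k with
  | zero => exact p.elim0
  | succ k =>
    set σ : Equiv.Perm (Fin (k + 1)) := Equiv.swap 0 p with hσ
    have hσ0 : σ 0 = p := Equiv.swap_apply_left _ _
    have hinj : Function.Injective ((g ∘ σ) ∘ Fin.succ) :=
      (hg.comp σ.injective).comp (Fin.succ_injective _)
    have hne : ∀ a : Fin k, σ a.succ ≠ p := fun a h =>
      Fin.succ_ne_zero a (σ.injective (h.trans hσ0.symm))
    have e1 : vdm (Function.update g p t ∘ σ) =
        (∏ a : Fin k, (((g (σ a.succ) : ℕ) : ℝ) - (t : ℕ))) * vdm ((g ∘ σ) ∘ Fin.succ) := by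
      rw [vdm_succ]
      have : (Function.update g p t ∘ σ) ∘ Fin.succ = (g ∘ σ) ∘ Fin.succ := by
        ext a; simp [hne]
      rw [this]
      simp [hσ0, hne]
    have e2 : vdm (g ∘ σ) =
        (∏ a : Fin k, (((g (σ a.succ) : ℕ) : ℝ) - (g p : ℕ))) * vdm ((g ∘ σ) ∘ Fin.succ) := by
      rw [vdm_succ]; simp [hσ0]
    refine ⟨vdm ((g ∘ σ) ∘ Fin.succ) ^ 2, by have := vdm_ne_zero hinj; positivity, ?_⟩
    have e3 : ∏ q ∈ univ.erase p,
          ((((g q : ℕ) : ℝ) - (t : ℕ)) * (((g q : ℕ) : ℝ) - (g p : ℕ))) =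
        ∏ a : Fin k, ((((g (σ a.succ) : ℕ) : ℝ) - (t : ℕ)) *
          (((g (σ a.succ) : ℕ) : ℝ) - (g p : ℕ))) := by
      have : univ.erase p = univ.image fun a : Fin k => σ a.succ := by
        ext q
        simp only [mem_erase, mem_univ, and_true, mem_image, true_and]
        constructor
        · intro hq
          have h0 : σ.symm q ≠ 0 := fun h => hq (by rw [← hσ0, ← h, Equiv.apply_symm_apply])
          obtain ⟨a, ha⟩ := Fin.exists_succ_eq.2 h0
          exact ⟨a, by rw [ha, Equiv.apply_symm_apply]⟩
        · rintro ⟨a, rfl⟩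
          exact hne a
      rw [this, prod_image fun a _ b _ h => Fin.succ_injective _ (σ.injective h)]
    rw [e3, prod_mul_distrib]
    rw [vdm_comp] at e1 e2
    linear_combination
      -(vdm (Function.update g p t) * vdm g) * sign_mul_self σ +
      (Equiv.Perm.sign σ : ℤ) * vdm g * e1 +
      (∏ a : Fin k, (((g (σ a.succ) : ℕ) : ℝ) - (t : ℕ))) * vdm ((g ∘ σ) ∘ Fin.succ) * e2

/-- The sign of the ratio of two top minors differing in one column. -/
lemma ratio_mul_prod_nonneg {n k : ℕ} {x : Mat n} (hx : totNonneg x) (hk : k ≤ n)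
    {g : Fin k → Fin n} (hg : Function.Injective g) (p : Fin k) (t : Fin n) {c : ℝ}
    (h0 : topMinor x hk g ≠ 0)
    (hc : topMinor x hk (Function.update g p t) = c * topMinor x hk g) :
    0 ≤ c * ∏ q ∈ univ.erase p,
      ((((g q : ℕ) : ℝ) - (t : ℕ)) * (((g q : ℕ) : ℝ) - (g p : ℕ))) := by
  obtain ⟨W, hW, h⟩ := vdm_update_mul hg p t
  have h1 := topMinor_mul_vdm_nonneg hx hk g
  have h2 := topMinor_mul_vdm_nonneg hx hk (Function.update g p t)
  rw [hc] at h2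
  have h3 := mul_nonneg h1 h2
  have h4 : 0 < topMinor x hk g ^ 2 * W := by positivity
  refine nonneg_of_mul_nonneg_right (b := c * _) ?_ h4
  linear_combination h3 + topMinor x hk g ^ 2 * c * h

end Signs

section Gauss

open Matrix Finset

lemma gaussPlus_spec {n : ℕ} {y : Mat n} (h : hasGauss y) :
    upperUni (gaussPlus y) ∧ ∃ L : Mat n, (∀ i j : Fin n, i < j → L i j = 0) ∧
      (∀ i, L i i ≠ 0) ∧ y = L * gaussPlus y := by
  have hs := h.choose_spec.choose_spec.choose_spec
  have e : gaussPlus y = h.choose_spec.choose_spec.choose := by rw [gaussPlus, dif_pos h]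
  rw [← e] at hs
  obtain ⟨a, d, ha, hd, hb, hy⟩ : ∃ a d : Mat n, lowerUni a ∧ diagInv d ∧
      upperUni (gaussPlus y) ∧ y = a * d * gaussPlus y := ⟨_, _, hs⟩
  have hmul (i j : Fin n) : (a * d) i j = a i j * d j j := by
    rw [Matrix.mul_apply]
    refine sum_eq_single j (fun s _ hs => ?_) (by simp)
    rw [hd.2 s j hs, mul_zero]
  have hdet : d.det = ∏ i, d i i :=
    Matrix.det_of_isUpperTriangular fun i j hij => hd.2 i j (ne_of_gt hij)
  refine ⟨hb, a * d, fun i j hij => by rw [hmul, ha.2 i j hij, zero_mul], fun i => ?_, hy⟩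
  rw [hmul, ha.1, one_mul]
  have h0 := hd.1.ne_zero
  rw [hdet] at h0
  exact prod_ne_zero_iff.1 h0 i (mem_univ i)

lemma perm_inv_apply_self {n : ℕ} (u : Equiv.Perm (Fin n)) (i : Fin n) : u⁻¹ (u i) = i :=
  u.symm_apply_apply i

lemma Amat_eq {n : ℕ} (u : Equiv.Perm (Fin n)) (x : Mat n) :
    Amat u x = (gaussPlus (x * permMat u⁻¹)).submatrix u u := by
  ext i j
  have (i k : Fin n) : i = u⁻¹ k ↔ k = u i := by
    rw [Equiv.Perm.eq_inv_iff_eq]; exact eq_comm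
  simp only [Amat, permMat, Matrix.mul_apply, of_apply, submatrix_apply, this]
  simp

lemma mul_permMat_inv_apply {n : ℕ} (u : Equiv.Perm (Fin n)) (x : Mat n) (r q : Fin n) :
    (x * permMat u⁻¹) r q = x r (u⁻¹ q) := by
  simp [permMat, Matrix.mul_apply]

lemma sum_castLE {n k : ℕ} (hk : k ≤ n) {f : Fin n → ℝ} (hf : ∀ s : Fin n, k ≤ s → f s = 0) :
    ∑ s, f s = ∑ s : Fin k, f (Fin.castLE hk s) := by
  refine Eq.trans ?_ (sum_map univ (Fin.castLEEmb hk) f)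
  symm
  refine sum_subset (subset_univ _) fun s _ hs => hf s ?_
  by_contra! h
  exact hs (mem_map.2 ⟨⟨s, h⟩, mem_univ _, rfl⟩)

variable {n : ℕ} {u : Equiv.Perm (Fin n)} {x Y L : Mat n}

lemma topMinor_eq_det_mul (hL : ∀ i j : Fin n, i < j → L i j = 0)
    (hy : x * permMat u⁻¹ = L * Y) {k : ℕ} (hk : k ≤ n) (g : Fin k → Fin n) :
    topMinor x hk g = (∏ a : Fin k, L (Fin.castLE hk a) (Fin.castLE hk a)) *
      (Matrix.of fun a b : Fin k => Y (Fin.castLE hk a) (u (g b))).det := by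
  have hdet : (Matrix.of fun a b : Fin k => L (Fin.castLE hk a) (Fin.castLE hk b)).det =
      ∏ a : Fin k, L (Fin.castLE hk a) (Fin.castLE hk a) :=
    Matrix.det_of_isLowerTriangular _ fun a b hab => hL _ _ (by simpa using hab)
  rw [← hdet, ← Matrix.det_mul, topMinor]
  congr 1
  ext a b
  have h := congrFun (congrFun hy (Fin.castLE hk a)) (u (g b))
  rw [mul_permMat_inv_apply, perm_inv_apply_self, Matrix.mul_apply, sum_castLE hk] at h
  · simpa [Matrix.mul_apply] using h
  · intro s hs
    rw [hL _ _ (Fin.lt_def.2 (lt_of_lt_of_le a.2 hs)), zero_mul]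

lemma topMinor_initial (hY : upperUni Y) (hL : ∀ i j : Fin n, i < j → L i j = 0)
    (hy : x * permMat u⁻¹ = L * Y) {k : ℕ} (hk : k ≤ n) :
    topMinor x hk (fun a => u⁻¹ (Fin.castLE hk a)) =
      ∏ a : Fin k, L (Fin.castLE hk a) (Fin.castLE hk a) := by
  rw [topMinor_eq_det_mul hL hy, Matrix.det_of_isUpperTriangular]
  · simp [hY.1]
  · intro a b hab
    simpa using hY.2 _ _ (by simpa using hab)

lemma topMinor_update_last (hY : upperUni Y) (hL : ∀ i j : Fin n, i < j → L i j = 0)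
    (hy : x * permMat u⁻¹ = L * Y) {k : ℕ} (hk : k + 1 ≤ n) (t : Fin n) :
    topMinor x hk (Function.update (fun a => u⁻¹ (Fin.castLE hk a)) (Fin.last k) t) =
      Y (Fin.castLE hk (Fin.last k)) (u t) *
        topMinor x hk (fun a => u⁻¹ (Fin.castLE hk a)) := by
  rw [topMinor_initial hY hL hy, topMinor_eq_det_mul hL hy, Matrix.det_of_isUpperTriangular,
    mul_comm, Fin.prod_univ_castSucc]
  · simp [hY.1, (Fin.castSucc_lt_last _).ne]
  · intro a b hab
    have hb : b ≠ Fin.last k := (lt_of_lt_of_le hab (Fin.le_last a)).ne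
    simpa [hb] using hY.2 _ _ (by simpa using hab)

lemma upperUni.isUnit_det (hY : upperUni Y) : IsUnit Y.det := by
  rw [Matrix.det_of_isUpperTriangular fun i j hij => hY.2 i j hij]
  simp [hY.1]

lemma upperUni.inv_apply_eq_zero (hY : upperUni Y) {i j : Fin n} (h : j < i) : Y⁻¹ i j = 0 := by
  have := Matrix.invertibleOfIsUnitDet Y hY.isUnit_det
  exact Matrix.blockTriangular_inv_of_blockTriangular (b := id)
    (fun i j hij => hY.2 i j hij) h

lemma upperUni.inv_apply_self (hY : upperUni Y) (i : Fin n) : Y⁻¹ i i = 1 := by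
  have h := congrFun (congrFun (Matrix.nonsing_inv_mul Y hY.isUnit_det) i) i
  rw [Matrix.mul_apply, sum_eq_single i, hY.1, mul_one, Matrix.one_apply_eq] at h
  · exact h
  · intro s _ hs
    rcases lt_or_gt_of_ne hs with hs | hs
    · rw [hY.inv_apply_eq_zero hs, zero_mul]
    · rw [hY.2 _ _ hs, mul_zero]
  · simp

lemma topMinor_update_inv (hY : upperUni Y) (hL : ∀ i j : Fin n, i < j → L i j = 0)
    (hy : x * permMat u⁻¹ = L * Y) (b : Fin n) (a : Fin b) :
    topMinor x b.2.le (Function.update (fun a => u⁻¹ (Fin.castLE b.2.le a)) a (u⁻¹ b)) =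
      -(Y⁻¹ (Fin.castLE b.2.le a) b) *
        topMinor x b.2.le (fun a => u⁻¹ (Fin.castLE b.2.le a)) := by
  have hyL : x * permMat u⁻¹ * Y⁻¹ = L := by
    rw [hy, Matrix.mul_nonsing_inv_cancel_right _ _ hY.isUnit_det]
  have hcol (r : Fin b) : x (Fin.castLE b.2.le r) (u⁻¹ b) =
      ∑ s : Fin b, -(Y⁻¹ (Fin.castLE b.2.le s) b) *
        x (Fin.castLE b.2.le r) (u⁻¹ (Fin.castLE b.2.le s)) := by
    have h := congrFun (congrFun hyL (Fin.castLE b.2.le r)) b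
    rw [hL _ _ (Fin.lt_def.2 r.2), Matrix.mul_apply, sum_castLE (k := b + 1) b.2,
      Fin.sum_univ_castSucc] at h
    · have e : Fin.castLE b.2 (Fin.last (b : ℕ)) = b := rfl
      simp only [mul_permMat_inv_apply, e, hY.inv_apply_self, Fin.castLE_castSucc] at h
      simp only [neg_mul, sum_neg_distrib]
      simp only [mul_comm (Y⁻¹ _ _)]
      linear_combination h
    · intro s hs
      rw [hY.inv_apply_eq_zero (Fin.lt_def.2 hs), mul_zero]
  have h := Matrix.det_updateCol_sum (Matrix.of fun r s : Fin b =>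
    x (Fin.castLE b.2.le r) (u⁻¹ (Fin.castLE b.2.le s))) a
    (fun s => -(Y⁻¹ (Fin.castLE b.2.le s) b))
  rw [smul_eq_mul] at h
  rw [topMinor, topMinor, ← h]
  congr 1
  ext r s
  by_cases hs : s = a
  · subst hs
    simpa using hcol r
  · simp [hs]

/-- The product of differences over the columns other than the `p`-th, as a product over column
indices. -/
lemma prod_erase_eq {k : ℕ} (hk : k ≤ n) (p : Fin k) (f : Fin n → ℝ) :
    ∏ q ∈ univ.erase p, f (u⁻¹ (Fin.castLE hk q)) =
      ∏ q ∈ univ.filter (fun q => (u q : ℕ) < k ∧ u q ≠ Fin.castLE hk p), f q := by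
  refine prod_bij (fun q _ => u⁻¹ (Fin.castLE hk q)) ?_ ?_ ?_ (fun _ _ => rfl)
  · intro q hq
    simpa using hq
  · intro q _ r _ h
    exact Fin.castLE_injective hk (u⁻¹.injective h)
  · intro q hq
    simp only [mem_filter, mem_univ, true_and] at hq
    refine ⟨⟨u q, hq.1⟩, ?_, by simp⟩
    simp only [mem_erase, mem_univ, and_true]
    exact fun h => hq.2 (congrArg (Fin.castLE hk) h)

lemma apply_mul_prod_nonneg (hx : totNonneg x) (hY : upperUni Y)
    (hL : ∀ i j : Fin n, i < j → L i j = 0) (hL0 : ∀ i, L i i ≠ 0)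
    (hy : x * permMat u⁻¹ = L * Y) (i t : Fin n) :
    0 ≤ Y (u i) (u t) * ∏ q ∈ univ.filter (fun q => u q < u i),
      ((((q : ℕ) : ℝ) - (t : ℕ)) * (((q : ℕ) : ℝ) - (i : ℕ))) := by
  have hk : (u i : ℕ) + 1 ≤ n := (u i).2
  have e : Fin.castLE hk (Fin.last (u i : ℕ)) = u i := rfl
  have hg : Function.Injective fun a => u⁻¹ (Fin.castLE hk a) :=
    u⁻¹.injective.comp (Fin.castLE_injective hk)
  have h0 := topMinor_initial hY hL hy hk
  have h := ratio_mul_prod_nonneg hx hk hg (Fin.last _) t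
    (h0 ▸ prod_ne_zero_iff.2 fun _ _ => hL0 _) (topMinor_update_last hY hL hy hk t)
  rw [prod_erase_eq hk (Fin.last _) fun q => (((q : ℕ) : ℝ) - (t : ℕ)) *
    (((q : ℕ) : ℝ) - (u⁻¹ (Fin.castLE hk (Fin.last _)) : Fin n)), e, perm_inv_apply_self] at h
  convert h using 4 with q
  rw [Fin.lt_def, ne_eq, Fin.ext_iff]
  omega

lemma neg_inv_mul_prod_nonneg (hx : totNonneg x) (hY : upperUni Y)
    (hL : ∀ i j : Fin n, i < j → L i j = 0) (hL0 : ∀ i, L i i ≠ 0)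
    (hy : x * permMat u⁻¹ = L * Y) {i j : Fin n} (hij : u j < u i) :
    0 ≤ -Y⁻¹ (u j) (u i) * ∏ q ∈ univ.filter (fun q => u q < u i ∧ q ≠ j),
      ((((q : ℕ) : ℝ) - (i : ℕ)) * (((q : ℕ) : ℝ) - (j : ℕ))) := by
  have hk : (u i : ℕ) ≤ n := (u i).2.le
  have hg : Function.Injective fun a => u⁻¹ (Fin.castLE hk a) :=
    u⁻¹.injective.comp (Fin.castLE_injective hk)
  have e : Fin.castLE hk ⟨u j, hij⟩ = u j := rfl
  have h0 := topMinor_initial hY hL hy hk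
  have h := ratio_mul_prod_nonneg hx hk hg ⟨u j, hij⟩ _
    (h0 ▸ prod_ne_zero_iff.2 fun _ _ => hL0 _) (topMinor_update_inv hY hL hy (u i) ⟨u j, hij⟩)
  rw [prod_erase_eq hk ⟨u j, hij⟩ fun q => (((q : ℕ) : ℝ) - (u⁻¹ (u i) : Fin n)) *
    (((q : ℕ) : ℝ) - (u⁻¹ (Fin.castLE hk ⟨u j, hij⟩) : Fin n)), e, perm_inv_apply_self,
    perm_inv_apply_self] at h
  simpa using h

lemma sub_mul_sub_succ_pos {q j : ℕ} (h1 : q ≠ j) (h2 : q ≠ j + 1) :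
    (0 : ℝ) < ((q : ℝ) - j) * ((q : ℝ) - (j + 1 : ℕ)) := by
  rcases lt_or_gt_of_ne h1 with h | h
  · have h3 : (q : ℝ) < j := by exact_mod_cast h
    push_cast
    nlinarith
  · have h3 : ((j + 1 : ℕ) : ℝ) < q := by exact_mod_cast (show j + 1 < q by omega)
    push_cast at h3 ⊢
    nlinarith

/-- The common form of the sign statements. -/
lemma sub_mul_inv_mul_nonneg (hx : totNonneg x) (hY : upperUni Y)
    (hL : ∀ i j : Fin n, i < j → L i j = 0) (hL0 : ∀ i, L i i ≠ 0)
    (hy : x * permMat u⁻¹ = L * Y) {i j t : Fin n} (ht : (t : ℕ) = j + 1)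
    (hij : u j < u i) (hit : u i ≤ u t) :
    0 ≤ (((j : ℕ) : ℝ) - (i : ℕ)) * (Y⁻¹ (u j) (u i) * Y (u i) (u t)) := by
  have h1 := neg_inv_mul_prod_nonneg hx hY hL hL0 hy hij
  have h2 := apply_mul_prod_nonneg hx hY hL hL0 hy i t
  have hins : univ.filter (fun q => u q < u i) =
      insert j (univ.filter fun q => u q < u i ∧ q ≠ j) := by
    ext q
    by_cases hq : q = j <;> simp [hq, hij]
  rw [hins, prod_insert (by simp), ht] at h2
  set s := univ.filter fun q => u q < u i ∧ q ≠ j with hs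
  have hpos : 0 < ∏ q ∈ s, ((((q : ℕ) : ℝ) - (i : ℕ)) * (((q : ℕ) : ℝ) - (j : ℕ)) *
      ((((q : ℕ) : ℝ) - (j + 1 : ℕ)) * (((q : ℕ) : ℝ) - (i : ℕ)))) := by
    refine prod_pos fun q hq => ?_
    obtain ⟨hqi, hqj⟩ : u q < u i ∧ q ≠ j := by simpa [hs] using hq
    have hqt : (q : ℕ) ≠ j + 1 := fun h => by
      have : q = t := Fin.ext (h.trans ht.symm)
      exact absurd hit (not_le.2 (this ▸ hqi))
    have hq0 : ((q : ℕ) : ℝ) - (i : ℕ) ≠ 0 := by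
      rw [sub_ne_zero]
      intro h
      exact hqi.ne (congrArg u (Fin.ext (Nat.cast_injective h)))
    have := mul_pos (sub_mul_sub_succ_pos (fun h => hqj (Fin.ext h)) hqt) (sq_pos_of_ne_zero hq0)
    linear_combination this
  rw [prod_mul_distrib] at hpos
  refine nonneg_of_mul_nonneg_left (a := _ * _) (le_of_le_of_eq (mul_nonneg h1 h2) ?_) hpos
  push_cast
  ring

end Gauss

theorem statement16 (n : ℕ) (hn : 1 ≤ n) (u : Equiv.Perm (Fin n)) (x : Mat n)
    (hx : upperUni x) (htnn : totNonneg x) (hg : hasGauss (x * permMat u⁻¹))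
    (i j : Fin n) (hj : (j : ℕ) + 1 < n) :
    ((i ≤ j ∧ u j ≤ u i ∧ u i ≤ u ⟨(j : ℕ) + 1, hj⟩) →
      0 ≤ (Amat u x)⁻¹ j i * Amat u x i ⟨(j : ℕ) + 1, hj⟩) ∧
    ((j < i ∧ u j ≤ u i ∧ u i ≤ u ⟨(j : ℕ) + 1, hj⟩) →
      (Amat u x)⁻¹ j i * Amat u x i ⟨(j : ℕ) + 1, hj⟩ ≤ 0) ∧
    (¬(u j ≤ u i ∧ u i ≤ u ⟨(j : ℕ) + 1, hj⟩) →
      (Amat u x)⁻¹ j i * Amat u x i ⟨(j : ℕ) + 1, hj⟩ = 0) := by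
  obtain ⟨hY, L, hL, hL0, hy⟩ := gaussPlus_spec hg
  rw [Amat_eq, Matrix.inv_submatrix_equiv]
  simp only [Matrix.submatrix_apply]
  set Y := gaussPlus (x * permMat u⁻¹)
  set t : Fin n := ⟨(j : ℕ) + 1, hj⟩ with ht
  have key (h1 : u j ≤ u i) (h2 : u i ≤ u t) (hij : i ≠ j) :
      0 ≤ (((j : ℕ) : ℝ) - (i : ℕ)) * (Y⁻¹ (u j) (u i) * Y (u i) (u t)) :=
    sub_mul_inv_mul_nonneg htnn hY hL hL0 hy rfl
      (lt_of_le_of_ne h1 fun h => hij (u.injective h).symm) h2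
  refine ⟨?_, ?_, ?_⟩
  · rintro ⟨hij, h1, h2⟩
    rcases hij.eq_or_lt with rfl | hij
    · have h := apply_mul_prod_nonneg htnn hY hL hL0 hy i t
      rw [hY.inv_apply_self, one_mul]
      refine nonneg_of_mul_nonneg_left h (Finset.prod_pos fun q hq => ?_)
      have hqi : u q < u i := by simpa using hq
      rw [mul_comm]
      refine sub_mul_sub_succ_pos (fun h => hqi.ne (congrArg u (Fin.ext h))) fun h => ?_
      have : q = t := Fin.ext h
      exact absurd h2 (not_le.2 (this ▸ hqi))
    · refine nonneg_of_mul_nonneg_right (key h1 h2 hij.ne) (sub_pos.2 ?_)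
      exact_mod_cast hij
  · rintro ⟨hij, h1, h2⟩
    have hlt : ((j : ℕ) : ℝ) < (i : ℕ) := by exact_mod_cast hij
    have := key h1 h2 hij.ne'
    nlinarith
  · intro h
    rcases not_and_or.1 h with h | h
    · rw [hY.inv_apply_eq_zero (not_le.1 h), zero_mul]
    · rw [hY.2 _ _ (not_le.1 h), mul_zero]

end BruhatTNN
end

section
/- Let u ∈ S_n, let x ∈ N be totally nonnegative with x u⁻¹ ∈ G_0, set A = u⁻¹ [x u⁻¹]_+ u, and let ν = diag(n, n-1, …, 1) be the diagonal matrix with diagonal entries n, n-1, …, 1. Then Σ_{j=1}^{n-1} (A⁻¹ ν A)_{j,j+1} ≥ 0, i.e. the sum of the entries of A⁻¹ ν A immediately above the main diagonal is nonnegative. -/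
open scoped Classical

namespace BruhatTNN

variable {n : ℕ}

theorem totNonneg.det_nonneg {x : Mat n} (hx : totNonneg x) {k : ℕ} {f g : Fin k → Fin n}
    (hf : StrictMono f) (hg : StrictMono g) : 0 ≤ (x.submatrix f g).det := by
  have hI : (Finset.univ.image f).card = k := by
    rw [Finset.card_image_of_injective _ hf.injective, Finset.card_fin]
  have hJ : (Finset.univ.image g).card = k := by
    rw [Finset.card_image_of_injective _ hg.injective, Finset.card_fin]
  have h := hx k _ _ hI hJ
  have hf' := Finset.orderEmbOfFin_unique hI (f := f) (by simp) hf
  have hg' := Finset.orderEmbOfFin_unique hJ (f := g) (by simp) hg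
  rw [minorOf, ← hf', ← hg'] at h
  exact h

theorem totNonneg.mul_det_updateCol_of_strictMono {x : Mat n} (hx : totNonneg x) {m : ℕ}
    {f c : Fin (m + 1) → Fin n} (hf : StrictMono f) (hc : StrictMono c) (i : Fin (m + 1)) :
    0 ≤ (x.submatrix f c).det *
      ((x.submatrix f c).updateCol i (Pi.single (Fin.last m) 1)).det *
      (-1) ^ (Finset.univ.filter fun i' => c i < c i').card := by
  have hcard : (Finset.univ.filter fun i' => c i < c i').card = m - i := by
    have : (Finset.univ.filter fun i' => c i < c i') = Finset.Ioi i := by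
      ext i'
      simp [hc.lt_iff_lt]
    rw [this, Fin.card_Ioi]
    omega
  have hdet : ((x.submatrix f c).updateCol i (Pi.single (Fin.last m) 1)).det =
      (-1) ^ (m + (i : ℕ)) * (x.submatrix (f ∘ Fin.castSucc) (c ∘ i.succAbove)).det := by
    rw [Matrix.det_succ_column _ i, Finset.sum_eq_single (Fin.last m)]
    · rw [Matrix.submatrix_updateCol_succAbove, Matrix.submatrix_submatrix]
      simp
    · intro b _ hb
      simp [hb]
    · simp
  have hsign : (-1 : ℝ) ^ (m + (i : ℕ)) * (-1) ^ (m - (i : ℕ)) = 1 := by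
    rw [← pow_add, show m + (i : ℕ) + (m - i) = 2 * m by omega, pow_mul]
    simp
  have h1 := hx.det_nonneg hf hc
  have h2 := hx.det_nonneg (hf.comp Fin.strictMono_castSucc) (hc.comp i.strictMono_succAbove)
  rw [hcard, hdet]
  calc (0 : ℝ) ≤ _ := mul_nonneg h1 h2
    _ = (x.submatrix f c).det * (x.submatrix (f ∘ Fin.castSucc) (c ∘ i.succAbove)).det *
        ((-1 : ℝ) ^ (m + (i : ℕ)) * (-1) ^ (m - (i : ℕ))) := by rw [hsign, mul_one]
    _ = _ := by ring

/-- Replacing column `i` by the last basis vector changes the sign of the determinant by the parity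
of the number of column indices exceeding `c i`. -/
theorem totNonneg.mul_det_updateCol {x : Mat n} (hx : totNonneg x) {m : ℕ}
    {f c : Fin (m + 1) → Fin n} (hf : StrictMono f) (hc : Function.Injective c)
    (i : Fin (m + 1)) :
    0 ≤ (x.submatrix f c).det *
      ((x.submatrix f c).updateCol i (Pi.single (Fin.last m) 1)).det *
      (-1) ^ (Finset.univ.filter fun i' => c i < c i').card := by
  set σ := Tuple.sort c
  have hmono : StrictMono (c ∘ σ) :=
    (Tuple.monotone_sort c).strictMono_of_injective (hc.comp σ.injective)
  have h := hx.mul_det_updateCol_of_strictMono hf hmono (σ.symm i)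
  have hcard : (Finset.univ.filter fun i' => (c ∘ σ) (σ.symm i) < (c ∘ σ) i').card =
      (Finset.univ.filter fun i' => c i < c i').card := by
    refine Finset.card_bij (fun a _ => σ a) ?_ ?_ ?_
    · simp
    · intro a _ b _ hab
      exact σ.injective hab
    · intro b hb
      exact ⟨σ.symm b, by simpa using hb, by simp⟩
  have h1 : (x.submatrix f (c ∘ σ)).det = Equiv.Perm.sign σ * (x.submatrix f c).det :=
    Matrix.det_permute' σ (x.submatrix f c)
  have h2 : ((x.submatrix f (c ∘ σ)).updateCol (σ.symm i) (Pi.single (Fin.last m) 1)).det =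
      Equiv.Perm.sign σ *
        ((x.submatrix f c).updateCol i (Pi.single (Fin.last m) 1)).det := by
    rw [← Matrix.det_permute']
    congr 1
    ext a b
    by_cases hb : b = σ.symm i
    · subst hb
      simp
    · have hb' : σ b ≠ i := fun h => hb (by simp [← h])
      simp [hb, hb']
  have hs : ((Equiv.Perm.sign σ : ℤ) : ℝ) * (Equiv.Perm.sign σ : ℤ) = 1 := by
    rcases Int.units_eq_one_or (Equiv.Perm.sign σ) with h | h <;> simp [h]
  rw [hcard, h1, h2] at h
  calc (0 : ℝ) ≤ _ := h
    _ = ((Equiv.Perm.sign σ : ℤ) : ℝ) * (Equiv.Perm.sign σ : ℤ) * ((x.submatrix f c).det *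
      ((x.submatrix f c).updateCol i (Pi.single (Fin.last m) 1)).det *
      (-1) ^ (Finset.univ.filter fun i' => c i < c i').card) := by ring
    _ = _ := by rw [hs, one_mul]

/-- The leading rows of a product with a lower triangular left factor. -/
theorem submatrix_castLE_mul {P Q : Mat n} (hP : ∀ i j : Fin n, i < j → P i j = 0)
    {k : ℕ} (h : k ≤ n) {ι : Type*} (f : ι → Fin n) :
    (P * Q).submatrix (Fin.castLE h) f =
      P.submatrix (Fin.castLE h) (Fin.castLE h) * Q.submatrix (Fin.castLE h) f := by
  ext i j
  simp only [Matrix.submatrix_apply, Matrix.mul_apply]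
  refine (Finset.sum_of_injOn (Fin.castLE h) (Fin.castLE_injective h).injOn (by simp) ?_
    (fun _ _ => rfl)).symm
  intro l _ hl
  have : Fin.castLE h i < l := by
    by_contra! hle
    refine hl ⟨⟨l, lt_of_le_of_lt (Fin.le_def.1 hle) (by simp)⟩, by simp, by ext; simp⟩
  rw [hP _ _ this, zero_mul]

theorem upperUni.det_eq_one {U : Mat n} (hU : upperUni U) : U.det = 1 := by
  rw [Matrix.det_of_isUpperTriangular (fun i j h => hU.2 i j h)]
  simp [hU.1]

theorem upperUni.inv {U : Mat n} (hU : upperUni U) : upperUni U⁻¹ := by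
  have hunit : IsUnit U.det := by simp [hU.det_eq_one]
  let _ := Matrix.invertibleOfIsUnitDet U hunit
  have htri : ∀ i j : Fin n, j < i → U⁻¹ i j = 0 := fun i j h =>
    Matrix.blockTriangular_inv_of_blockTriangular (b := id) (fun i j h => hU.2 i j h) h
  refine ⟨fun i => ?_, htri⟩
  have h := congr_fun (congr_fun (Matrix.mul_nonsing_inv U hunit) i) i
  rw [Matrix.mul_apply, Finset.sum_eq_single i, hU.1, one_mul, Matrix.one_apply_eq] at h
  · exact h
  · intro l _ hl
    rcases hl.lt_or_gt with h | h
    · rw [hU.2 _ _ h, zero_mul]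
    · rw [htri _ _ h, mul_zero]
  · simp

theorem upperUni.submatrix_castLE {U : Mat n} (hU : upperUni U) {k : ℕ} (h : k ≤ n) :
    upperUni (U.submatrix (Fin.castLE h) (Fin.castLE h)) :=
  ⟨fun _ => hU.1 _, fun _ _ hij => hU.2 _ _ hij⟩

theorem upperUni.det_submatrix_castLE_update {U : Mat n} (hU : upperUni U) {m : ℕ}
    (h : m + 1 ≤ n) (b : Fin n) :
    ((U.submatrix (Fin.castLE h)
      (Function.update (Fin.castLE h) (Fin.last m) b))).det =
      U (Fin.castLE h (Fin.last m)) b := by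
  rw [Matrix.det_of_isUpperTriangular, Fin.prod_univ_castSucc]
  · simp [hU.1]
  · intro i j hij
    have hj : j ≠ Fin.last m := (lt_of_lt_of_le hij (Fin.le_last i)).ne
    simpa [Function.update_of_ne hj] using hU.2 _ _ (show Fin.castLE h j < Fin.castLE h i from hij)

/-- Cramer's rule for the last column of the inverse of a leading block. -/
theorem upperUni.det_updateCol_single {U : Mat n} (hU : upperUni U) {m : ℕ} (h : m + 1 ≤ n)
    (a : Fin (m + 1)) :
    ((U.submatrix (Fin.castLE h) (Fin.castLE h)).updateCol a (Pi.single (Fin.last m) 1)).det =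
      U⁻¹ (Fin.castLE h a) (Fin.castLE h (Fin.last m)) := by
  set W := U.submatrix (Fin.castLE h) (Fin.castLE h)
  have hunit : IsUnit U.det := by simp [hU.det_eq_one]
  set v : Fin (m + 1) → ℝ := fun i => U⁻¹ (Fin.castLE h i) (Fin.castLE h (Fin.last m))
  have hv : W.mulVec v = Pi.single (Fin.last m) 1 := by
    ext i
    have h1 := congr_fun (congr_fun (Matrix.mul_nonsing_inv U hunit) (Fin.castLE h i))
      (Fin.castLE h (Fin.last m))
    rw [Matrix.one_apply, Matrix.mul_apply] at h1
    have h2 : W.mulVec v i = ∑ l, U (Fin.castLE h i) l * U⁻¹ l (Fin.castLE h (Fin.last m)) := by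
      rw [Matrix.mulVec, dotProduct]
      refine Finset.sum_of_injOn (Fin.castLE h) (Fin.castLE_injective h).injOn (by simp) ?_
        (fun _ _ => rfl)
      intro l _ hl
      have : Fin.castLE h (Fin.last m) < l := by
        by_contra! hle
        refine hl ⟨⟨l, Nat.lt_succ_of_le (Fin.le_def.1 hle)⟩, by simp, rfl⟩
      rw [hU.inv.2 _ _ this, mul_zero]
    rw [h2, h1, Pi.single_apply]
    simp [Fin.ext_iff]
  rw [← Matrix.cramer_apply, ← hv, Matrix.cramer_eq_adjugate_mulVec, Matrix.mulVec_mulVec,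
    Matrix.adjugate_mul, (hU.submatrix_castLE h).det_eq_one]
  simp [v]

/-- Replacing a column of the leading block of `P * U` by the last basis vector. -/
theorem det_updateCol_mul_single {P U : Mat n} (hP : ∀ i j : Fin n, i < j → P i j = 0)
    (hU : upperUni U) {m : ℕ} (h : m + 1 ≤ n)
    (hm : P (Fin.castLE h (Fin.last m)) (Fin.castLE h (Fin.last m)) ≠ 0) (a : Fin (m + 1)) :
    (((P * U).submatrix (Fin.castLE h) (Fin.castLE h)).updateCol a
      (Pi.single (Fin.last m) 1)).det =
    (P.submatrix (Fin.castLE h) (Fin.castLE h)).det /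
      P (Fin.castLE h (Fin.last m)) (Fin.castLE h (Fin.last m)) *
      U⁻¹ (Fin.castLE h a) (Fin.castLE h (Fin.last m)) := by
  set d := P (Fin.castLE h (Fin.last m)) (Fin.castLE h (Fin.last m))
  have hcol : (Pi.single (Fin.last m) 1 : Fin (m + 1) → ℝ) =
      d⁻¹ • (P.submatrix (Fin.castLE h) (Fin.castLE h)).mulVec (Pi.single (Fin.last m) 1) := by
    ext i
    rw [Matrix.mulVec_single_one]
    by_cases hi : i = Fin.last m
    · subst hi
      simp [d, hm]
    · have : P (Fin.castLE h i) (Fin.castLE h (Fin.last m)) = 0 :=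
        hP _ _ (show i < Fin.last m from lt_of_le_of_ne (Fin.le_last i) hi)
      simp [hi, this]
  rw [submatrix_castLE_mul hP, hcol, Matrix.det_updateCol_smul, ← Matrix.mul_updateCol,
    Matrix.det_mul, hU.det_updateCol_single h a]
  field_simp

/-- The sign of `(A⁻¹)_{j r} A_{r j'}` for `A = u⁻¹ U u` and `j' = j + 1`. -/
theorem sign_mul_inv_mul_nonneg {u : Equiv.Perm (Fin n)} {x P U : Mat n} (htnn : totNonneg x)
    (hP : ∀ i j : Fin n, i < j → P i j = 0) (hPd : ∀ i, P i i ≠ 0) (hU : upperUni U)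
    (hxu : x.submatrix id u.symm = P * U) {j j' r : Fin n} (hj : (j : ℕ) + 1 = j') :
    0 ≤ (if j < r then (-1 : ℝ) else 1) * (U⁻¹ (u j) (u r) * U (u r) (u j')) := by
  rcases lt_or_ge (u r) (u j) with hlt | haj
  · rw [hU.inv.2 _ _ hlt]
    simp
  rcases lt_or_ge (u j') (u r) with hlt | hbj
  · rw [hU.2 _ _ hlt]
    simp
  obtain ⟨m, hm⟩ : ∃ m : ℕ, m = (u r : ℕ) := ⟨_, rfl⟩
  have h : m + 1 ≤ n := by have := (u r).2; omega
  set E : Fin (m + 1) → Fin n := Fin.castLE h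
  have hlast : E (Fin.last m) = u r := by ext; simp [E, hm]
  obtain ⟨a, ha⟩ : ∃ a, E a = u j :=
    ⟨⟨u j, by have := Fin.le_def.1 haj; omega⟩, by ext; simp [E]⟩
  have hE : StrictMono E := Fin.strictMono_castLE h
  have hne : ∀ i, i ≠ Fin.last m → E i ≠ u j' := by
    intro i hi heq
    have h1 : E i < E (Fin.last m) := hE (lt_of_le_of_ne (Fin.le_last i) hi)
    rw [heq, hlast] at h1
    exact absurd hbj (not_le.2 h1)
  set E' : Fin (m + 1) → Fin n := Function.update E (Fin.last m) (u j')
  have hE'inj : Function.Injective E' := by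
    intro s t hst
    by_cases hs : s = Fin.last m <;> by_cases ht : t = Fin.last m
    · rw [hs, ht]
    · simp only [E', hs, Function.update_self, Function.update_of_ne ht] at hst
      exact absurd hst.symm (hne t ht)
    · simp only [E', ht, Function.update_self, Function.update_of_ne hs] at hst
      exact absurd hst (hne s hs)
    · simp only [E', Function.update_of_ne hs, Function.update_of_ne ht] at hst
      exact hE.injective hst
  have hsub : ∀ f : Fin (m + 1) → Fin n, x.submatrix E (u.symm ∘ f) = (P * U).submatrix E f := by
    intro f
    rw [← hxu]
    rfl
  have hA := htnn.mul_det_updateCol hE (u.symm.injective.comp hE.injective) a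
  have hB := htnn.mul_det_updateCol hE (u.symm.injective.comp hE'inj) (Fin.last m)
  have hupd : ((P * U).submatrix E E').updateCol (Fin.last m) (Pi.single (Fin.last m) 1) =
      ((P * U).submatrix E E).updateCol (Fin.last m) (Pi.single (Fin.last m) 1) := by
    ext s t
    by_cases ht : t = Fin.last m
    · simp [ht]
    · simp [ht, E']
  have hcount : (Finset.univ.filter fun i => (u.symm ∘ E) a < (u.symm ∘ E) i).card =
      (Finset.univ.filter fun i =>
        (u.symm ∘ E') (Fin.last m) < (u.symm ∘ E') i).card + if j < r then 1 else 0 := by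
    have hiff : ∀ i, i ≠ Fin.last m → (j' < u.symm (E i) ↔ j < u.symm (E i)) := by
      intro i hi
      have : u.symm (E i) ≠ j' := fun h => hne i hi (by simp [← h])
      have : ((u.symm (E i) : Fin n) : ℕ) ≠ j' := fun h => this (Fin.ext h)
      simp only [Fin.lt_def]
      omega
    rw [Finset.card_filter, Finset.card_filter, Fin.sum_univ_castSucc, Fin.sum_univ_castSucc]
    simp only [Function.comp_apply, ha, hlast, E', Function.update_self,
      Function.update_of_ne (Fin.castSucc_lt_last _).ne, Equiv.symm_apply_apply, lt_irrefl,
      if_false, add_zero]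
    congr 1
    refine Finset.sum_congr rfl fun i _ => ?_
    simp only [hiff _ (Fin.castSucc_lt_last i).ne]
  set p := (P.submatrix E E).det
  have hp : p ≠ 0 := by
    rw [show p = ∏ i, P (E i) (E i) from
      Matrix.det_of_isLowerTriangular _ fun s t hst => hP _ _ (hE hst)]
    exact Finset.prod_ne_zero_iff.2 fun i _ => hPd _
  set d := P (u r) (u r)
  have hd : d ≠ 0 := hPd _
  have hpos : 0 < p ^ 4 / d ^ 2 := by positivity
  have e1 : ((P * U).submatrix E E).det = p := by
    rw [submatrix_castLE_mul hP, Matrix.det_mul, (hU.submatrix_castLE h).det_eq_one, mul_one]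
  have e2 : ((P * U).submatrix E E').det = p * U (u r) (u j') := by
    rw [submatrix_castLE_mul hP, Matrix.det_mul, hU.det_submatrix_castLE_update h, ← hlast]
  have e3 : ∀ i, (((P * U).submatrix E E).updateCol i (Pi.single (Fin.last m) 1)).det =
      p / d * U⁻¹ (E i) (u r) := by
    intro i
    rw [det_updateCol_mul_single hP hU h (hPd _) i]
    simp only [← hlast, d, E, p]
  rw [hsub, e1, e3, ha, hcount] at hA
  rw [hsub, hupd, e2, e3, hlast, hU.inv.1] at hB
  set N := (Finset.univ.filter fun i =>
        (u.symm ∘ E') (Fin.last m) < (u.symm ∘ E') i).card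
  have hN : (-1 : ℝ) ^ N * (-1) ^ N = 1 := by
    rw [← mul_pow]
    simp
  have hpow : (-1 : ℝ) ^ (if j < r then 1 else 0) = if j < r then (-1 : ℝ) else 1 := by
    split_ifs <;> simp
  rw [pow_add, hpow] at hA
  refine nonneg_of_mul_nonneg_right ?_ hpos
  calc (0 : ℝ) ≤ _ := mul_nonneg hA hB
    _ = ((-1 : ℝ) ^ N * (-1) ^ N) * (p ^ 4 / d ^ 2 * ((if j < r then (-1 : ℝ) else 1) *
        (U⁻¹ (u j) (u r) * U (u r) (u j')))) := by ring
    _ = _ := by rw [hN, one_mul]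

theorem mul_permMat (M : Mat n) (w : Equiv.Perm (Fin n)) : M * permMat w = M.submatrix id w := by
  ext i j
  simp [Matrix.mul_apply, permMat]

theorem permMat_inv_mul (M : Mat n) (w : Equiv.Perm (Fin n)) :
    permMat w⁻¹ * M = M.submatrix w id := by
  ext i j
  have hiff : ∀ l, i = w⁻¹ l ↔ w i = l := fun l => Equiv.Perm.eq_inv_iff_eq
  simp only [Matrix.mul_apply, permMat, Matrix.of_apply, hiff]
  simp

theorem exists_gaussPlus {y : Mat n} (hy : hasGauss y) :
    ∃ P : Mat n, (∀ i j : Fin n, i < j → P i j = 0) ∧ (∀ i, P i i ≠ 0) ∧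
      upperUni (gaussPlus y) ∧ y = P * gaussPlus y := by
  obtain ⟨hL, hD, hU, hyeq⟩ := hy.choose_spec.choose_spec.choose_spec
  rw [gaussPlus, dif_pos hy]
  set L := hy.choose
  set D := hy.choose_spec.choose
  have hDdiag : D = Matrix.diagonal fun i => D i i := by
    ext i j
    by_cases hij : i = j
    · simp [hij]
    · simp [hij, hD.2 i j hij]
  have happ : ∀ i j, (L * D) i j = L i j * D j j := by
    intro i j
    rw [hDdiag, Matrix.mul_diagonal]
    simp
  refine ⟨L * D, fun i j hij => ?_, fun i => ?_, hU, hyeq⟩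
  · rw [happ, hL.2 i j hij, zero_mul]
  · have hdet := hD.1.ne_zero
    rw [hDdiag, Matrix.det_diagonal] at hdet
    rw [happ, hL.1, one_mul]
    exact Finset.prod_ne_zero_iff.1 hdet i (Finset.mem_univ i)

theorem statement17 (n : ℕ) (hn : 1 ≤ n) (u : Equiv.Perm (Fin n)) (x : Mat n)
    (hx : upperUni x) (htnn : totNonneg x) (hg : hasGauss (x * permMat u⁻¹)) :
    0 ≤ strAbove ((Amat u x)⁻¹ *
      Matrix.diagonal (fun i : Fin n => ((n - (i : ℕ) : ℕ) : ℝ)) * Amat u x) := by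
  obtain ⟨P, hP, hPd, hU, hxu⟩ := exists_gaussPlus hg
  set U := gaussPlus (x * permMat u⁻¹) with hUdef
  have hAU : Amat u x = U.submatrix u u := by
    rw [Amat, permMat_inv_mul, mul_permMat, ← hUdef]
    rfl
  have hAinv : (U.submatrix u u)⁻¹ = U⁻¹.submatrix u u := Matrix.inv_submatrix_equiv U u u
  have hAdet : IsUnit (U.submatrix u u).det := by
    rw [Matrix.det_submatrix_equiv_self, hU.det_eq_one]
    exact isUnit_one
  rw [mul_permMat] at hxu
  refine Finset.sum_nonneg fun ⟨j, j'⟩ _ => ?_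
  split_ifs with hj
  swap
  · exact le_rfl
  dsimp only at hj ⊢
  have hjj : j ≠ j' := fun h => by simp [h] at hj
  have hzero := congr_fun (congr_fun (Matrix.nonsing_inv_mul _ hAdet) j) j'
  rw [Matrix.mul_apply, Matrix.one_apply_ne hjj] at hzero
  rw [hAU, hAinv, Matrix.mul_apply]
  rw [hAinv] at hzero
  simp only [Matrix.mul_diagonal, Matrix.submatrix_apply] at hzero ⊢
  calc (0 : ℝ) ≤ ∑ r, ((j : ℝ) - r) * (U⁻¹ (u j) (u r) * U (u r) (u j')) := by
        refine Finset.sum_nonneg fun r _ => ?_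
        have h := sign_mul_inv_mul_nonneg htnn hP hPd hU hxu (r := r) hj
        split_ifs at h with hjr
        · have : (j : ℝ) ≤ r := by exact_mod_cast hjr.le
          exact mul_nonneg_of_nonpos_of_nonpos (by linarith) (by linarith)
        · have : (r : ℝ) ≤ j := by exact_mod_cast not_lt.1 hjr
          exact mul_nonneg (by linarith) (by linarith)
    _ = ∑ r, (U⁻¹ (u j) (u r) * ((n - (r : ℕ) : ℕ) : ℝ) * U (u r) (u j') -
          ((n : ℝ) - j) * (U⁻¹ (u j) (u r) * U (u r) (u j'))) := by
        refine Finset.sum_congr rfl fun r _ => ?_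
        rw [Nat.cast_sub r.2.le]
        ring
    _ = _ := by rw [Finset.sum_sub_distrib, ← Finset.mul_sum, hzero, mul_zero, sub_zero]

end BruhatTNN
end

section
/- (Verma's theorem, type A.) Let u, v ∈ S_n with u ≤ v and u ≠ v in the Bruhat order. Then Σ_{w : u ≤ w ≤ v} (-1)^{ℓ(w)} = 0, where the sum is over all w ∈ S_n in the Bruhat interval [u,v], and ℓ(w) denotes the number of inversions of the permutation w (i.e. the number of pairs i < j with w(i) > w(j)). Equivalently, every Bruhat interval [u,v] with u ≠ v contains equally many permutations of even and odd length. -/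
open scoped Classical

namespace BruhatTNN

/-- The number of positions `k < m` with `j ≤ w k`. -/
def prefixCount {n : ℕ} (w : Equiv.Perm (Fin n)) (m : ℕ) (j : Fin n) : ℕ :=
  (Finset.univ.filter fun k : Fin n => (k : ℕ) < m ∧ j ≤ w k).card

theorem prefixCount_succ {n : ℕ} (w : Equiv.Perm (Fin n)) (i j : Fin n) :
    prefixCount w (i + 1) j = prefixCount w i j + if j ≤ w i then 1 else 0 := by
  unfold prefixCount
  split_ifs with h
  · rw [← Finset.card_insert_of_notMem (a := i) (by simp)]
    congr 1
    ext k
    simp only [Finset.mem_filter, Finset.mem_univ, true_and, Finset.mem_insert]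
    grind
  · rw [add_zero]
    congr 1
    ext k
    simp only [Finset.mem_filter, Finset.mem_univ, true_and]
    grind

theorem bruhatLE_iff_prefixCount {n : ℕ} {u v : Equiv.Perm (Fin n)} :
    bruhatLE u v ↔ ∀ m j, m ≤ n → prefixCount u m j ≤ prefixCount v m j := by
  have key (w : Equiv.Perm (Fin n)) (i j : Fin n) :
      (Finset.univ.filter fun k : Fin n => k ≤ i ∧ j ≤ w k).card = prefixCount w (i + 1) j := by
    simp only [prefixCount, Nat.lt_succ_iff, Fin.le_def]
  simp only [bruhatLE, key]
  constructor
  · rintro h (_ | m) j hm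
    · simp [prefixCount]
    · exact h ⟨m, hm⟩ j
  · exact fun h i j => h _ _ i.isLt

theorem bruhatLE_refl {n : ℕ} (u : Equiv.Perm (Fin n)) : bruhatLE u u := fun _ _ => le_rfl

theorem bruhatLE.trans {n : ℕ} {u v w : Equiv.Perm (Fin n)} (h : bruhatLE u v)
    (h' : bruhatLE v w) : bruhatLE u w := fun i j => (h i j).trans (h' i j)

theorem prefixCount_mul_swap_of_ne {n : ℕ} (w : Equiv.Perm (Fin n)) {p q : Fin n}
    (hpq : (q : ℕ) = p + 1) {m : ℕ} (hm : m ≠ p + 1) (j : Fin n) :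
    prefixCount (w * Equiv.swap p q) m j = prefixCount w m j := by
  refine Finset.card_equiv (Equiv.swap p q) fun k => ?_
  rw [Finset.mem_filter, Finset.mem_filter]
  simp only [Finset.mem_univ, true_and, Equiv.Perm.mul_apply]
  refine and_congr_left fun _ => ?_
  rw [Equiv.swap_apply_def]
  grind

theorem prefixCount_mul_swap {n : ℕ} (w : Equiv.Perm (Fin n)) {p q : Fin n}
    (hpq : (q : ℕ) = p + 1) (j : Fin n) :
    prefixCount (w * Equiv.swap p q) (p + 1) j =
      prefixCount w p j + if j ≤ w q then 1 else 0 := by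
  rw [prefixCount_succ, prefixCount_mul_swap_of_ne w hpq (by omega), Equiv.Perm.mul_apply,
    Equiv.swap_apply_left]

/-- If `v` has a descent at `p`, its lower set is closed under swapping positions `p`, `p + 1`. -/
theorem bruhatLE.mul_swap_left {n : ℕ} {w v : Equiv.Perm (Fin n)} {p q : Fin n}
    (hpq : (q : ℕ) = p + 1) (hv : v q < v p) (h : bruhatLE w v) :
    bruhatLE (w * Equiv.swap p q) v := by
  rw [bruhatLE_iff_prefixCount] at h ⊢
  intro m j hm
  by_cases hmp : m = p + 1
  · subst hmp
    have h₀ := h p j p.isLt.le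
    have h₂ := h (q + 1) j q.isLt
    have hw := prefixCount_succ w p j
    have hv' := prefixCount_succ v p j
    rw [prefixCount_succ, prefixCount_succ, hpq] at h₂
    rw [prefixCount_mul_swap w hpq, hv']
    grind
  · rw [prefixCount_mul_swap_of_ne w hpq hmp]
    exact h m j hm

/-- If `u` has an ascent at `p`, its upper set is closed under swapping positions `p`, `p + 1`. -/
theorem bruhatLE.mul_swap_right {n : ℕ} {u w : Equiv.Perm (Fin n)} {p q : Fin n}
    (hpq : (q : ℕ) = p + 1) (hu : u p < u q) (h : bruhatLE u w) :
    bruhatLE u (w * Equiv.swap p q) := by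
  rw [bruhatLE_iff_prefixCount] at h ⊢
  intro m j hm
  by_cases hmp : m = p + 1
  · subst hmp
    have h₀ := h p j p.isLt.le
    have h₂ := h (q + 1) j q.isLt
    have hw := prefixCount_succ w p j
    have hu' := prefixCount_succ u p j
    rw [prefixCount_succ, prefixCount_succ, hpq] at h₂
    rw [prefixCount_mul_swap w hpq, hu']
    grind
  · rw [prefixCount_mul_swap_of_ne w hpq hmp]
    exact h m j hm

theorem not_bruhatLE_mul_swap {n : ℕ} {v : Equiv.Perm (Fin n)} {p q : Fin n}
    (hpq : (q : ℕ) = p + 1) (hv : v q < v p) : ¬ bruhatLE v (v * Equiv.swap p q) := by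
  rw [bruhatLE_iff_prefixCount]
  intro h
  have h₁ := h (p + 1) (v p) p.isLt
  rw [prefixCount_mul_swap v hpq, prefixCount_succ, if_pos le_rfl, if_neg hv.not_ge] at h₁
  omega

theorem eq_one_of_bruhatLE_one {n : ℕ} {u : Equiv.Perm (Fin n)} (h : bruhatLE u 1) : u = 1 := by
  have hle (i : Fin n) : u i ≤ i := by
    by_contra! hi
    have hpos : 0 < (Finset.univ.filter fun k : Fin n => k ≤ i ∧ u i ≤ u k).card :=
      Finset.card_pos.2 ⟨i, by simp⟩
    obtain ⟨k, hk⟩ := Finset.card_pos.1 (hpos.trans_le (h i (u i)))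
    have hk' := (Finset.mem_filter.1 hk).2
    exact (hi.trans_le (hk'.2.trans hk'.1)).false
  have hsum : ∑ i, ((u i : Fin n) : ℕ) = ∑ i : Fin n, (i : ℕ) :=
    Equiv.sum_comp u fun i : Fin n => (i : ℕ)
  have heq := (Finset.sum_eq_sum_iff_of_le fun i _ => Fin.le_def.1 (hle i)).1 hsum
  ext i
  simpa using heq i (Finset.mem_univ i)

theorem exists_descent_of_ne_one {n : ℕ} {v : Equiv.Perm (Fin n)} (hv : v ≠ 1) :
    ∃ p q : Fin n, (q : ℕ) = p + 1 ∧ v q < v p := by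
  by_contra! h
  cases n with
  | zero => exact hv (Subsingleton.elim _ _)
  | succ n =>
    have hmono : Monotone v := Fin.monotone_iff_le_succ.2 fun i => h _ _ (by simp)
    have hstrict : StrictMono v := hmono.strictMono_of_injective v.injective
    refine hv (Equiv.ext fun i => ?_)
    have := Subsingleton.elim (hstrict.orderIsoOfSurjective v v.surjective) (OrderIso.refl _)
    simpa using DFunLike.congr_fun this i

theorem neg_one_pow_invNum {n : ℕ} (w : Equiv.Perm (Fin n)) :
    (-1 : ℤ) ^ invNum w = Equiv.Perm.sign w := by
  rw [Equiv.Perm.sign_eq_prod_prod_Ioi, invNum, ← Finset.prod_const, Finset.prod_filter,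
    Fintype.prod_prod_type]
  push_cast
  refine Finset.prod_congr rfl fun i _ => ?_
  rw [← Finset.prod_subset (Finset.subset_univ (Finset.Ioi i))]
  · refine Finset.prod_congr rfl fun j hj => ?_
    have hij := Finset.mem_Ioi.1 hj
    rcases (w.injective.ne hij.ne).lt_or_gt with h | h
    · simp [h, h.not_gt]
    · simp [h, h.not_gt, hij]
  · intro j _ hj
    rw [if_neg fun h => hj (Finset.mem_Ioi.2 h.1)]

theorem neg_one_pow_invNum_mul_swap {n : ℕ} (w : Equiv.Perm (Fin n)) {p q : Fin n}
    (hpq : p ≠ q) : (-1 : ℤ) ^ invNum (w * Equiv.swap p q) = -(-1) ^ invNum w := by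
  simp [neg_one_pow_invNum, Equiv.Perm.sign_swap hpq]

/-- The signed count of the elements of the Bruhat interval `[u, v]`. -/
noncomputable def intervalSum {n : ℕ} (u v : Equiv.Perm (Fin n)) : ℤ :=
  ∑ w : Equiv.Perm (Fin n), if bruhatLE u w ∧ bruhatLE w v then (-1 : ℤ) ^ invNum w else 0

theorem intervalSum_eq_zero_of_ascent_of_descent {n : ℕ} {u v : Equiv.Perm (Fin n)} {p q : Fin n}
    (hpq : (q : ℕ) = p + 1) (hu : u p < u q) (hv : v q < v p) : intervalSum u v = 0 := by
  have hL (w) : bruhatLE (w * Equiv.swap p q) v ↔ bruhatLE w v :=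
    ⟨fun h => by simpa [mul_assoc] using h.mul_swap_left hpq hv, fun h => h.mul_swap_left hpq hv⟩
  have hR (w) : bruhatLE u (w * Equiv.swap p q) ↔ bruhatLE u w :=
    ⟨fun h => by simpa [mul_assoc] using h.mul_swap_right hpq hu, fun h => h.mul_swap_right hpq hu⟩
  have hneg : intervalSum u v = -intervalSum u v := by
    conv_lhs => rw [intervalSum, ← Equiv.sum_comp (Equiv.mulRight (Equiv.swap p q))]
    rw [intervalSum, ← Finset.sum_neg_distrib]
    refine Finset.sum_congr rfl fun w _ => ?_
    simp only [Equiv.coe_mulRight, hL, hR,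
      neg_one_pow_invNum_mul_swap w (show p ≠ q by grind)]
    split_ifs <;> simp
  omega

theorem intervalSum_sub_of_descent {n : ℕ} {u v : Equiv.Perm (Fin n)} {p q : Fin n}
    (hpq : (q : ℕ) = p + 1) (hu : u q < u p) (hv : v q < v p) :
    intervalSum (u * Equiv.swap p q) v - intervalSum u v =
      intervalSum (u * Equiv.swap p q) (v * Equiv.swap p q) -
        intervalSum u (v * Equiv.swap p q) := by
  have hus : bruhatLE (u * Equiv.swap p q) u := (bruhatLE_refl u).mul_swap_left hpq hu
  have hvs : bruhatLE (v * Equiv.swap p q) v := (bruhatLE_refl v).mul_swap_left hpq hv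
  simp only [intervalSum, ← Finset.sum_sub_distrib]
  refine Finset.sum_congr rfl fun w _ => ?_
  by_cases huw : bruhatLE u w
  · simp [huw, hus.trans huw]
  by_cases husw : bruhatLE (u * Equiv.swap p q) w
  · have hw : w p < w q := by
      refine lt_of_le_of_ne (le_of_not_gt fun hw => huw ?_) fun h => ?_
      · simpa [mul_assoc] using husw.mul_swap_left hpq hw
      · have := w.injective h
        grind
    have : bruhatLE w v ↔ bruhatLE w (v * Equiv.swap p q) :=
      ⟨fun h => h.mul_swap_right hpq hw, fun h => h.trans hvs⟩
    simp [this, huw]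
  · simp [huw, husw]

theorem intervalSum_eq_zero_of_ne {n : ℕ} (v : Equiv.Perm (Fin n)) :
    ∀ u, u ≠ v → intervalSum u v = 0 := by
  induction hN : (Finset.univ.filter fun w => bruhatLE w v).card using Nat.strong_induction_on
    generalizing v with
  | _ N ih =>
    subst hN
    intro u hne
    by_cases hv1 : v = 1
    · subst hv1
      refine Finset.sum_eq_zero fun w _ => if_neg fun h => hne ?_
      exact eq_one_of_bruhatLE_one (h.1.trans h.2)
    obtain ⟨p, q, hpq, hv⟩ := exists_descent_of_ne_one hv1
    rcases lt_trichotomy (u p) (u q) with hu | hu | hu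
    · exact intervalSum_eq_zero_of_ascent_of_descent hpq hu hv
    · have := u.injective hu
      grind
    have hvs : bruhatLE (v * Equiv.swap p q) v := (bruhatLE_refl v).mul_swap_left hpq hv
    have ihs := ih _ (Finset.card_lt_card (Finset.ssubset_iff_of_subset (fun w hw => by
      simp only [Finset.mem_filter, Finset.mem_univ, true_and] at hw ⊢
      exact hw.trans hvs) |>.2 ⟨v, by simpa using bruhatLE_refl v, by
        simpa using not_bruhatLE_mul_swap hpq hv⟩)) (v * Equiv.swap p q) rfl
    have hrec := intervalSum_sub_of_descent hpq hu hv
    rw [intervalSum_eq_zero_of_ascent_of_descent hpq (by simpa using hu) hv,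
      ihs u (by rintro rfl; simp at hu; exact hu.not_gt hv),
      ihs _ (fun h => hne (mul_right_cancel h))] at hrec
    omega

theorem statement18 (n : ℕ) (u v : Equiv.Perm (Fin n))
    (huv : bruhatLE u v) (hne : u ≠ v) :
    ∑ w : Equiv.Perm (Fin n),
      (if bruhatLE u w ∧ bruhatLE w v then (-1 : ℤ) ^ invNum w else 0) = 0 := by
  exact intervalSum_eq_zero_of_ne v u hne

end BruhatTNN
end
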